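/- Let p ≥ 1 and let λ = (λ₁,…,λ_p) be nonincreasing nonnegative weights with 1 ≥ λ₁. Then for every u ∈ ℝ^p and γ ≥ 0, ‖η(u; γ, λ)‖₂² ≤ Σ_{i=1}^p ( sign(u_i)·max(0, |u_i| − γ‖λ‖₂²/p) )², i.e. the ℓ2-norm of the SLOPE proximal output is at most that of componentwise soft thresholding at level γ‖λ‖₂²/p, where ‖λ‖₂² = Σ_{i=1}^p λ_i². -/

import Mathlib

open MeasureTheory ProbabilityTheory Filter

/-- Standard Gaussian measure `N(0, I_n)` on `ℝⁿ`. -/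
noncomputable def stdGaussian (n : ℕ) : Measure (Fin n → ℝ) :=
  Measure.pi fun _ => gaussianReal 0 1

/-- The nonincreasing rearrangement of the absolute values of the entries of `x`. -/
noncomputable def sortedAbs {n : ℕ} (x : Fin n → ℝ) : Fin n → ℝ :=
  fun i => |x ((Tuple.sort fun j => -|x j|) i)|

/-- The sorted-ℓ1 (SLOPE) norm `‖x‖_λ = ∑ λ_i |x|_(i)`. -/
noncomputable def slopeNorm {n : ℕ} (lam x : Fin n → ℝ) : ℝ :=
  ∑ i, lam i * sortedAbs x i

/-- The SLOPE proximal objective `½‖u − v‖₂² + γ‖v‖_λ`. -/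
noncomputable def slopeObj {n : ℕ} (lam : Fin n → ℝ) (γ : ℝ) (u v : Fin n → ℝ) : ℝ :=
  (1/2) * ∑ i, (u i - v i)^2 + γ * slopeNorm lam v

/-- `v` is a minimizer of the SLOPE proximal objective, i.e. `v = η(u; γ, λ)`
(the minimizer is unique since the objective is strictly convex). -/
def IsSlopeProx {n : ℕ} (lam : Fin n → ℝ) (γ : ℝ) (u v : Fin n → ℝ) : Prop :=
  ∀ w, slopeObj lam γ u v ≤ slopeObj lam γ u w

/-- The sorted absolute values can be computed with any permutation that sorts them. -/
theorem sortedAbs_eq_comp {n : ℕ} (x : Fin n → ℝ) (σ : Equiv.Perm (Fin n))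
    (hσ : Monotone fun i => -|x (σ i)|) : sortedAbs x = fun i => |x (σ i)| := by
  have h := Tuple.unique_monotone (f := fun j => -|x j|)
    (Tuple.monotone_sort fun j => -|x j|) (show Monotone ((fun j => -|x j|) ∘ σ) from hσ)
  funext i
  simpa [sortedAbs] using congrFun h i

theorem antitone_sortedAbs {n : ℕ} (x : Fin n → ℝ) : Antitone (sortedAbs x) := by
  intro i j hij
  have h := Tuple.monotone_sort (fun j => -|x j|) hij
  simpa [sortedAbs] using h

theorem sum_sortedAbs {n : ℕ} (x : Fin n → ℝ) : ∑ i, sortedAbs x i = ∑ i, |x i| :=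
  Equiv.sum_comp (Tuple.sort fun j => -|x j|) fun i => |x i|

theorem slopeNorm_const_mul {n : ℕ} (lam x : Fin n → ℝ) {c : ℝ} (hc : 0 ≤ c) :
    slopeNorm lam (fun i => c * x i) = c * slopeNorm lam x := by
  have h : sortedAbs (fun i => c * x i) = fun i => c * sortedAbs x i := by
    rw [sortedAbs_eq_comp _ (Tuple.sort fun j => -|x j|)]
    · simp [sortedAbs, abs_mul, abs_of_nonneg hc]
    · intro i j hij
      have := mul_le_mul_of_nonneg_left (antitone_sortedAbs x hij) hc
      simpa [sortedAbs, abs_mul, abs_of_nonneg hc] using this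
  simp only [slopeNorm, h, Finset.mul_sum]
  exact Finset.sum_congr rfl fun i _ => by ring

/-- Chebyshev's inequality: the SLOPE norm dominates the `ℓ1` norm with the averaged weight. -/
theorem sum_mul_sum_abs_le_card_mul_slopeNorm {n : ℕ} {lam : Fin n → ℝ} (hlam : Antitone lam)
    (x : Fin n → ℝ) : (∑ i, lam i) * ∑ i, |x i| ≤ n * slopeNorm lam x := by
  simpa [slopeNorm, sum_sortedAbs] using
    (hlam.monovary (antitone_sortedAbs x)).sum_mul_sum_le_card_mul_sum

/-- Optimality of the SLOPE prox along the ray it spans. -/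
theorem IsSlopeProx.sum_sq_le {n : ℕ} {lam : Fin n → ℝ} {γ : ℝ} {u v : Fin n → ℝ}
    (hv : IsSlopeProx lam γ u v) :
    ∑ i, v i ^ 2 ≤ ∑ i, u i * v i - γ * slopeNorm lam v := by
  have expand (c : ℝ) : ∑ i, (u i - c * v i) ^ 2
      = ∑ i, u i ^ 2 - 2 * c * ∑ i, u i * v i + c ^ 2 * ∑ i, v i ^ 2 := by
    simp only [Finset.mul_sum, ← Finset.sum_sub_distrib, ← Finset.sum_add_distrib]
    exact Finset.sum_congr rfl fun i _ => by ring
  have hB : 0 ≤ ∑ i, v i ^ 2 := Finset.sum_nonneg fun i _ => sq_nonneg _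
  have key (ε : ℝ) (h0 : 0 < ε) (h1 : ε ≤ 1) :
      ∑ i, v i ^ 2 - (∑ i, u i * v i - γ * slopeNorm lam v) ≤ ε / 2 * ∑ i, v i ^ 2 := by
    have h := hv fun i => (1 - ε) * v i
    have e := expand 1
    simp only [one_mul] at e
    rw [slopeObj, slopeObj, slopeNorm_const_mul lam v (sub_nonneg.2 h1), expand, e] at h
    refine le_of_mul_le_mul_left ?_ h0
    linear_combination h
  by_contra! hlt
  set B := ∑ i, v i ^ 2
  set D := B - (∑ i, u i * v i - γ * slopeNorm lam v)
  have hD : 0 < D := sub_pos.2 hlt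
  have h := key (D / (B + D)) (by positivity) ((div_le_one (by positivity)).2 (by linarith))
  have hlt' : D / (B + D) / 2 * B < D := by
    rw [div_div, div_mul_eq_mul_div, div_lt_iff₀ (by positivity)]
    nlinarith [mul_nonneg hD.le hB, mul_pos hD hD]
  linarith

theorem sq_sign_mul_max_abs_sub (a : ℝ) {t : ℝ} (ht : 0 ≤ t) :
    (Real.sign a * max 0 (|a| - t)) ^ 2 = max 0 (|a| - t) ^ 2 := by
  rcases lt_trichotomy a 0 with h | rfl | h
  · simp [Real.sign_of_neg h]
  · simp [ht]
  · simp [Real.sign_of_pos h]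

/-- if `λ₁ ≤ 1`, the ℓ2-norm of the SLOPE proximal output is at most
that of componentwise soft thresholding at level `γ‖λ‖₂²/p`. -/
theorem slope_prox_dominated_by_soft_threshold
    (p : ℕ) (hp : 1 ≤ p)
    (lam : Fin p → ℝ)
    (hmono : ∀ i j : Fin p, i ≤ j → lam j ≤ lam i)
    (hnonneg : ∀ i, 0 ≤ lam i)
    (hlam_le : lam ⟨0, hp⟩ ≤ 1)
    (γ : ℝ) (hγ : 0 ≤ γ)
    (u v : Fin p → ℝ) (hv : IsSlopeProx lam γ u v) :
    (∑ i, (v i) ^ 2)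
      ≤ ∑ i, (Real.sign (u i) * max 0 (|u i| - γ * (∑ j, lam j ^ 2) / (p : ℝ))) ^ 2 := by
  set t := γ * (∑ j, lam j ^ 2) / (p : ℝ) with ht_def
  have hp0 : (0 : ℝ) < p := by exact_mod_cast hp
  have ht : 0 ≤ t := by positivity
  simp only [sq_sign_mul_max_abs_sub _ ht]
  have hsq : ∑ j, lam j ^ 2 ≤ ∑ j, lam j := Finset.sum_le_sum fun j _ => by
    have h1 : lam j ≤ 1 := (hmono ⟨0, hp⟩ j (Nat.zero_le _)).trans hlam_le
    nlinarith [hnonneg j]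
  have hnorm : t * ∑ i, |v i| ≤ γ * slopeNorm lam v := by
    have hl1 : 0 ≤ ∑ i, |v i| := Finset.sum_nonneg fun i _ => abs_nonneg _
    have h := (mul_le_mul_of_nonneg_right hsq hl1).trans
      (sum_mul_sum_abs_le_card_mul_slopeNorm (fun i j hij => hmono i j hij) v)
    rw [ht_def, div_mul_eq_mul_div, div_le_iff₀ hp0]
    linear_combination γ * h
  have hle : ∑ i, u i * v i - t * ∑ i, |v i| ≤ ∑ i, max 0 (|u i| - t) * |v i| := by
    rw [Finset.mul_sum, ← Finset.sum_sub_distrib]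
    refine Finset.sum_le_sum fun i _ => ?_
    have h1 : u i * v i ≤ |u i| * |v i| := (le_abs_self _).trans (abs_mul _ _).le
    have h2 := mul_le_mul_of_nonneg_right (le_max_right 0 (|u i| - t)) (abs_nonneg (v i))
    linarith
  have hprod : ∑ i, max 0 (|u i| - t) * |v i|
      ≤ ∑ i, (max 0 (|u i| - t) ^ 2 + v i ^ 2) / 2 :=
    Finset.sum_le_sum fun i _ => by
      nlinarith [sq_nonneg (max 0 (|u i| - t) - |v i|), sq_abs (v i)]
  rw [← Finset.sum_div, Finset.sum_add_distrib] at hprod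
  linarith [hv.sum_sq_le]
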